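/- Let A be a C*-algebra and let (aₙ)_{n≥0} be a sequence of positive contractions in A that are pairwise orthogonal (aₘaₙ = 0 for m ≠ n), and suppose that aₙ ◁ aₙ₊₁ for every n. Then the element a := Σ_{n=0}^∞ 2^{-n} aₙ (which converges in norm) is a soft positive element of A. -/

import Mathlib

/-!
Common definitions: softness for (non-unital) C*-algebras.

A C*-algebra is *soft* if it has no nonzero unital quotient; equivalently, for every
closed two-sided ideal `I` with `A/I ≠ 0`, the quotient `A/I` is not unital.
We encode properties of the quotient `A/I` intrinsically in `A`.
-/

variable {A : Type*}

/-- The quotient of `A` by the two-sided ideal `I` is unital: some `e ∈ A` represents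
a multiplicative unit of `A/I`. -/
def QuotUnital [NonUnitalNonAssocRing A] (I : TwoSidedIdeal A) : Prop :=
  ∃ e : A, ∀ x : A, x * e - x ∈ I ∧ e * x - x ∈ I

/-- The quotient of `A` by the two-sided ideal `I` is nonzero. -/
def QuotNonzero [NonUnitalNonAssocRing A] (I : TwoSidedIdeal A) : Prop :=
  ∃ x : A, x ∉ I

/-- A C*-algebra is *soft* if it has no nonzero unital quotient. -/
def IsSoftCStar (A : Type*) [NonUnitalNonAssocRing A] [TopologicalSpace A] : Prop :=
  ∀ I : TwoSidedIdeal A, IsClosed (I : Set A) → QuotNonzero I → ¬ QuotUnital I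

/-- `a ◁ b` : `a` belongs to the closed two-sided ideal generated by `b`. -/
def Lhd [NonUnitalNonAssocRing A] [TopologicalSpace A] (a b : A) : Prop :=
  ∀ I : TwoSidedIdeal A, IsClosed (I : Set A) → b ∈ I → a ∈ I

/-- The hereditary subalgebra associated to `x`: the closed linear span of `x* A x`
(the set `{x* y x : y ∈ A}` is closed under multiplication, so the non-unital
subalgebra it generates is its linear span). -/
def her [NonUnitalCStarAlgebra A] (x : A) : NonUnitalSubalgebra ℂ A :=
  (NonUnitalAlgebra.adjoin ℂ {z : A | ∃ y : A, z = star x * y * x}).topologicalClosure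

/-- An element `x` of a C*-algebra is *soft* if its hereditary subalgebra
`her x = span(x* A x)‾` is a soft C*-algebra. -/
def IsSoftElem [NonUnitalCStarAlgebra A] (x : A) : Prop :=
  IsSoftCStar (her x)

open Filter Topology Metric

section Hereditary

variable [NonUnitalCStarAlgebra A]

lemma isClosed_her (x : A) : IsClosed (her x : Set A) :=
  NonUnitalSubalgebra.isClosed_topologicalClosure _

lemma coe_her_eq_closure {x : A} (hx : IsSelfAdjoint x) :
    (her x : Set A) = closure (Set.range fun y : A => x * y * x) := by
  have key : ((NonUnitalAlgebra.adjoin ℂ {z : A | ∃ y : A, z = star x * y * x} :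
      NonUnitalSubalgebra ℂ A) : Set A) = Set.range fun y : A => x * y * x := by
    apply Set.Subset.antisymm
    · intro z hz
      induction hz using NonUnitalAlgebra.adjoin_induction with
      | mem z hz =>
        obtain ⟨y, rfl⟩ := hz
        exact ⟨y, by simp only [hx.star_eq]⟩
      | add p q _ _ hp hq =>
        obtain ⟨y, rfl⟩ := hp
        obtain ⟨z, rfl⟩ := hq
        exact ⟨y + z, by simp only [mul_add, add_mul]⟩
      | zero => exact ⟨0, by simp⟩
      | mul p q _ _ hp hq =>
        obtain ⟨y, rfl⟩ := hp
        obtain ⟨z, rfl⟩ := hq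
        exact ⟨y * x * x * z, by simp only [mul_assoc]⟩
      | smul r p _ hp =>
        obtain ⟨y, rfl⟩ := hp
        exact ⟨r • y, by simp only [mul_smul_comm, smul_mul_assoc]⟩
    · rintro _ ⟨y, rfl⟩
      exact NonUnitalAlgebra.subset_adjoin ℂ ⟨y, by simp only [hx.star_eq]⟩
  rw [← key]
  rfl

lemma mul_mul_self_mem_her {x : A} (hx : IsSelfAdjoint x) (y : A) : x * y * x ∈ her x := by
  rw [← SetLike.mem_coe, coe_her_eq_closure hx]
  exact subset_closure ⟨y, rfl⟩

/-- The subalgebra `her x` is hereditary. -/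
lemma mul_mul_mem_her {x : A} (hx : IsSelfAdjoint x) {p q : A} (hp : p ∈ her x)
    (hq : q ∈ her x) (y : A) : p * y * q ∈ her x := by
  rw [← SetLike.mem_coe, coe_her_eq_closure hx] at *
  refine map_mem_closure₂ (f := fun p q => p * y * q) (by fun_prop) hp hq ?_
  rintro _ ⟨y₁, rfl⟩ _ ⟨y₂, rfl⟩
  exact ⟨y₁ * x * y * x * y₂, by simp only [mul_assoc]⟩

lemma real_smul_mem {B : NonUnitalSubalgebra ℂ A} {x : A} (r : ℝ) (hx : x ∈ B) :
    r • x ∈ B := by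
  rw [← Complex.coe_smul]
  exact B.smul_mem _ hx

end Hereditary

/-- Approximate units of the form `b * w k * b` for a positive element `b`. -/
lemma exists_approximate_unit [NonUnitalCStarAlgebra A] [PartialOrder A] [StarOrderedRing A]
    {b : A} (hb : 0 ≤ b) :
    ∃ w : ℕ → A, (∀ k, ‖b * w k * b‖ ≤ 1) ∧
      Tendsto (fun k => b * w k * b * b) atTop (𝓝 b) ∧
      Tendsto (fun k => b * (b * w k * b)) atTop (𝓝 b) := by
  have hsa : IsSelfAdjoint b := hb.isSelfAdjoint
  have hnn : ∀ t ∈ quasispectrum ℝ b, 0 ≤ t := fun t ht => quasispectrum_nonneg_of_nonneg b hb t ht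
  have key : ∀ ε : ℝ, 0 < ε → ∃ w : A, ‖b * w * b‖ ≤ 1 ∧ ‖b * w * b * b - b‖ ≤ ε ∧
      b * (b * w * b) = b * w * b * b := by
    intro ε hε
    have hc : ContinuousOn (fun t : ℝ => t / (t ^ 3 + ε ^ 3)) (quasispectrum ℝ b) := by
      refine ContinuousOn.div (by fun_prop) (by fun_prop) fun t ht => ?_
      have := hnn t ht
      positivity
    have hid : ContinuousOn (fun t : ℝ => t) (quasispectrum ℝ b) := continuousOn_id
    set w : A := cfcₙ (fun t : ℝ => t / (t ^ 3 + ε ^ 3)) b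
    have hbw : b * w * b = cfcₙ (fun t : ℝ => t * (t / (t ^ 3 + ε ^ 3)) * t) b := by
      rw [cfcₙ_mul (fun t : ℝ => t * (t / (t ^ 3 + ε ^ 3))) (fun t => t) b
        (hid.mul hc) (by simp) hid rfl, cfcₙ_mul (fun t : ℝ => t) _ b hid rfl hc (by simp),
        cfcₙ_id' ℝ b]
    have hc' : ContinuousOn (fun t : ℝ => t * (t / (t ^ 3 + ε ^ 3)) * t) (quasispectrum ℝ b) :=
      (hid.mul hc).mul hid
    refine ⟨w, ?_, ?_, ?_⟩
    · rw [hbw]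
      refine norm_cfcₙ_le fun t ht => ?_
      have ht := hnn t ht
      rw [Real.norm_of_nonneg (by positivity),
        show t * (t / (t ^ 3 + ε ^ 3)) * t = t ^ 3 / (t ^ 3 + ε ^ 3) by ring]
      exact div_le_one_of_le₀ (by have := pow_pos hε 3; linarith) (by positivity)
    · have : b * w * b * b - b =
          cfcₙ (fun t : ℝ => t * (t / (t ^ 3 + ε ^ 3)) * t * t - t) b := by
        rw [cfcₙ_sub (fun t : ℝ => t * (t / (t ^ 3 + ε ^ 3)) * t * t) (fun t => t) b
          (hc'.mul hid) (by simp) hid rfl,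
          cfcₙ_mul (fun t : ℝ => t * (t / (t ^ 3 + ε ^ 3)) * t) (fun t => t) b
          hc' (by simp) hid rfl, ← hbw, cfcₙ_id' ℝ b]
      rw [this]
      refine norm_cfcₙ_le fun t ht => ?_
      have ht := hnn t ht
      have hpos : 0 < t ^ 3 + ε ^ 3 := by positivity
      rw [show t * (t / (t ^ 3 + ε ^ 3)) * t * t - t = -(ε ^ 3 * t / (t ^ 3 + ε ^ 3)) by
        field_simp; ring, norm_neg, Real.norm_of_nonneg (by positivity), div_le_iff₀ hpos]
      have h : ε ^ 2 * t ≤ t ^ 3 + ε ^ 3 := by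
        rcases le_total t ε with h | h
        · nlinarith [pow_nonneg ht 3, mul_le_mul_of_nonneg_left h (sq_nonneg ε)]
        · nlinarith [pow_pos hε 3,
            mul_le_mul_of_nonneg_right (pow_le_pow_left₀ hε.le h 2) ht]
      nlinarith [mul_le_mul_of_nonneg_left h hε.le]
    · have hcomm : b * w = w * b := ((Commute.refl b).cfcₙ_real _).eq.symm
      rw [hcomm, ← mul_assoc, ← mul_assoc, hcomm]
  choose w h₁ h₂ h₃ using fun k : ℕ => key (1 / ((k : ℝ) + 1)) Nat.one_div_pos_of_nat
  have hlim : Tendsto (fun k => b * w k * b * b) atTop (𝓝 b) :=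
    tendsto_iff_norm_sub_tendsto_zero.2 <|
      squeeze_zero (fun _ => norm_nonneg _) h₂ tendsto_one_div_add_atTop_nhds_zero_nat
  exact ⟨w, h₁, hlim, by simpa only [h₃] using hlim⟩

section Ideal

variable [NonUnitalCStarAlgebra A] {B : NonUnitalSubalgebra ℂ A} {I : TwoSidedIdeal B}

lemma isClosed_image_ideal (hB : IsClosed (B : Set A)) (hI : IsClosed (I : Set B)) :
    IsClosed (Subtype.val '' (I : Set B)) :=
  hB.isClosedEmbedding_subtypeVal.isClosedMap _ hI

lemma image_ideal_mul_mem {p x : A} (hp : p ∈ B) (hx : x ∈ Subtype.val '' (I : Set B)) :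
    p * x ∈ Subtype.val '' (I : Set B) := by
  obtain ⟨x, hx, rfl⟩ := hx
  exact ⟨⟨p, hp⟩ * x, I.mul_mem_left _ _ hx, rfl⟩

lemma image_ideal_mem_mul {p x : A} (hp : p ∈ B) (hx : x ∈ Subtype.val '' (I : Set B)) :
    x * p ∈ Subtype.val '' (I : Set B) := by
  obtain ⟨x, hx, rfl⟩ := hx
  exact ⟨x * ⟨p, hp⟩, I.mul_mem_right _ _ hx, rfl⟩

lemma image_ideal_add_mem {x y : A} (hx : x ∈ Subtype.val '' (I : Set B))
    (hy : y ∈ Subtype.val '' (I : Set B)) : x + y ∈ Subtype.val '' (I : Set B) := by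
  obtain ⟨x, hx, rfl⟩ := hx
  obtain ⟨y, hy, rfl⟩ := hy
  exact ⟨x + y, I.add_mem hx hy, rfl⟩

lemma zero_mem_image_ideal : (0 : A) ∈ Subtype.val '' (I : Set B) :=
  ⟨0, I.zero_mem, rfl⟩

/-- If `e` is a unit modulo a closed ideal and `b = lim u k * b` with `e * u k` uniformly of norm
at most `1 / 2`, then `b` belongs to the ideal. -/
lemma mem_image_ideal_of_norm_mul_le (hB : IsClosed (B : Set A)) (hI : IsClosed (I : Set B))
    {e : B} (he : ∀ x : B, e * x - x ∈ I) {b : A} (hb : b ∈ B) {u : ℕ → A}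
    (hu : ∀ k, u k ∈ B) (heu : ∀ k, ‖(e : A) * u k‖ ≤ 1 / 2)
    (hlim : Tendsto (fun k => u k * b) atTop (𝓝 b)) :
    b ∈ Subtype.val '' (I : Set B) := by
  set K : Set A := Subtype.val '' (I : Set B)
  have hne : K.Nonempty := ⟨0, zero_mem_image_ideal⟩
  have hstep : ∀ k, infDist (u k * b) K ≤ 1 / 2 * infDist b K := by
    intro k
    suffices h : 2 * infDist (u k * b) K ≤ infDist b K by linarith
    refine (le_infDist hne).2 fun y hy => ?_
    have hyB : y ∈ B := by
      obtain ⟨y, -, rfl⟩ := hy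
      exact y.2
    have hmem : u k * y + -((e : A) * (u k * (b - y)) - u k * (b - y)) ∈ K := by
      refine image_ideal_add_mem (image_ideal_mul_mem (hu k) hy) ?_
      exact ⟨-(e * ⟨u k * (b - y), B.mul_mem (hu k) (B.sub_mem hb hyB)⟩ -
        ⟨u k * (b - y), B.mul_mem (hu k) (B.sub_mem hb hyB)⟩), I.neg_mem (he _), rfl⟩
    have h := infDist_le_dist_of_mem (x := u k * b) hmem
    have heq : u k * b - (u k * y + -((e : A) * (u k * (b - y)) - u k * (b - y))) =
        (e : A) * u k * (b - y) := by
      simp only [mul_sub, mul_assoc]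
      abel
    rw [dist_eq_norm, heq] at h
    have h' := norm_mul_le ((e : A) * u k) (b - y)
    have h'' := mul_le_mul_of_nonneg_right (heu k) (norm_nonneg (b - y))
    rw [dist_eq_norm]
    linarith
  have hle : infDist b K ≤ 1 / 2 * infDist b K :=
    le_of_tendsto (((continuous_infDist_pt K).tendsto b).comp hlim) (.of_forall hstep)
  have h0 : infDist b K = 0 := le_antisymm (by linarith) infDist_nonneg
  exact ((isClosed_image_ideal hB hI).mem_iff_infDist_zero hne).2 h0

/-- A closed ideal `I` of a hereditary subalgebra `B` is the trace on `B` of a closed ideal of the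
ambient algebra, so `x ◁ y` and `y ∈ I` imply `x ∈ I` for `x, y ∈ B`. -/
lemma Lhd.mem_image_ideal (hB : IsClosed (B : Set A)) (hI : IsClosed (I : Set B))
    (hher : ∀ p ∈ B, ∀ q ∈ B, ∀ y : A, p * y * q ∈ B) {x y : A} (hxy : Lhd x y)
    {u v : ℕ → A} (hu : ∀ k, u k ∈ B) (hv : ∀ k, v k ∈ B)
    (hux : Tendsto (fun k => u k * x) atTop (𝓝 x)) (hxu : Tendsto (fun k => x * u k) atTop (𝓝 x))
    (hvy : Tendsto (fun k => v k * y) atTop (𝓝 y)) (hyv : Tendsto (fun k => y * v k) atTop (𝓝 y))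
    (hy : y ∈ Subtype.val '' (I : Set B)) : x ∈ Subtype.val '' (I : Set B) := by
  set K : Set A := Subtype.val '' (I : Set B)
  have hKc : IsClosed K := isClosed_image_ideal hB hI
  let S : Set A := {t | ∀ p ∈ B, ∀ q ∈ B, ∀ c d : A, p * c * t * d * q ∈ K}
  let J : TwoSidedIdeal A := TwoSidedIdeal.mk' S
    (fun p _ q _ c d => by
      rw [mul_zero, zero_mul, zero_mul]
      exact zero_mem_image_ideal)
    (fun {s t} hs ht p hp q hq c d => by
      simpa only [mul_add, add_mul] using image_ideal_add_mem (hs p hp q hq c d) (ht p hp q hq c d))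
    (fun {t} ht p hp q hq c d => by
      simpa only [mul_neg, neg_mul] using ht (-p) (B.neg_mem hp) q hq c d)
    (fun {s t} ht p hp q hq c d => by
      simpa only [mul_assoc] using ht p hp q hq (c * s) d)
    (fun {s t} hs p hp q hq c d => by
      simpa only [mul_assoc] using hs p hp q hq c (t * d))
  have hJ : (J : Set A) = S := by
    ext t
    exact TwoSidedIdeal.mem_mk' ..
  have hJc : IsClosed (J : Set A) := by
    rw [hJ]
    simp only [S, Set.ofPred_forall]
    refine isClosed_iInter fun p => isClosed_iInter fun _ => isClosed_iInter fun q =>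
      isClosed_iInter fun _ => isClosed_iInter fun c => isClosed_iInter fun d => ?_
    exact hKc.preimage (by fun_prop : Continuous fun t : A => p * c * t * d * q)
  have hyJ : y ∈ J := by
    rw [← SetLike.mem_coe, hJ]
    intro p hp q hq c d
    have h₁ : Tendsto (fun k => p * c * (v k * y) * d * q) atTop (𝓝 (p * c * y * d * q)) :=
      ((hvy.const_mul _).mul_const _).mul_const _
    refine hKc.mem_of_tendsto h₁ (.of_forall fun k => ?_)
    have h₂ : Tendsto (fun j => p * c * (v k * (y * v j)) * d * q) atTop
        (𝓝 (p * c * (v k * y) * d * q)) :=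
      (((hyv.const_mul _).const_mul _).mul_const _).mul_const _
    refine hKc.mem_of_tendsto h₂ (.of_forall fun j => ?_)
    have := image_ideal_mem_mul (hher (v j) (hv j) q hq d)
      (image_ideal_mul_mem (hher p hp (v k) (hv k) c) hy)
    simpa only [mul_assoc] using this
  have hxS : x ∈ S := hJ ▸ hxy J hJc hyJ
  refine hKc.mem_of_tendsto hux (.of_forall fun i => ?_)
  have h₁ : Tendsto (fun j => u i * (u j * x)) atTop (𝓝 (u i * x)) := hux.const_mul _
  refine hKc.mem_of_tendsto h₁ (.of_forall fun j => ?_)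
  have h₂ : Tendsto (fun k => u i * (u j * (x * u k))) atTop (𝓝 (u i * (u j * x))) :=
    (hxu.const_mul _).const_mul _
  refine hKc.mem_of_tendsto h₂ (.of_forall fun k => ?_)
  have h₃ : Tendsto (fun l => u i * (u j * (x * u l * u k))) atTop
      (𝓝 (u i * (u j * (x * u k)))) :=
    ((hxu.mul_const _).const_mul _).const_mul _
  refine hKc.mem_of_tendsto h₃ (.of_forall fun l => ?_)
  simpa only [mul_assoc] using hxS (u i) (hu i) (u k) (hu k) (u j) (u l)

end Ideal

/-- If `(aₙ)` is a sequence of pairwise orthogonal positive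
contractions with `aₙ ◁ aₙ₊₁` for all `n`, then `a := Σₙ 2⁻ⁿ aₙ` is a soft positive
element of `A`. -/
theorem isSoftElem_of_orthogonal_sequence [NonUnitalCStarAlgebra A]
    [PartialOrder A] [StarOrderedRing A]
    (a : ℕ → A) (hpos : ∀ n, 0 ≤ a n) (hcontr : ∀ n, ‖a n‖ ≤ 1)
    (horth : ∀ m n, m ≠ n → a m * a n = 0)
    (hlhd : ∀ n, Lhd (a n) (a (n + 1))) :
    0 ≤ (∑' n : ℕ, ((2 : ℝ) ^ n)⁻¹ • a n)
      ∧ IsSoftElem (∑' n : ℕ, ((2 : ℝ) ^ n)⁻¹ • a n) := by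
  have hsum : Summable fun n : ℕ => ((2 : ℝ) ^ n)⁻¹ • a n := by
    refine Summable.of_norm_bounded summable_geometric_two fun n => ?_
    rw [norm_smul, Real.norm_of_nonneg (by positivity), one_div, inv_pow]
    exact mul_le_of_le_one_right (by positivity) (hcontr n)
  have hx0 : 0 ≤ ∑' n : ℕ, ((2 : ℝ) ^ n)⁻¹ • a n :=
    tsum_nonneg fun n => smul_nonneg (by positivity) (hpos n)
  have hhas := hsum.hasSum
  refine ⟨hx0, ?_⟩
  set x : A := ∑' n : ℕ, ((2 : ℝ) ^ n)⁻¹ • a n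
  have hx : IsSelfAdjoint x := hx0.isSelfAdjoint
  have hxa : ∀ n, x * a n = ((2 : ℝ) ^ n)⁻¹ • (a n * a n) := fun n => by
    refine (hhas.mul_right (a n)).unique ?_
    rw [← smul_mul_assoc]
    exact hasSum_single n fun m hm => by rw [smul_mul_assoc, horth m n hm, smul_zero]
  have hax : ∀ n, a n * x = ((2 : ℝ) ^ n)⁻¹ • (a n * a n) := fun n => by
    refine (hhas.mul_left (a n)).unique ?_
    rw [← mul_smul_comm]
    exact hasSum_single n fun m hm => by rw [mul_smul_comm, horth n m hm.symm, smul_zero]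
  have hsq : ∀ n, a n * a n = (2 : ℝ) ^ n • (x * a n) ∧ a n * a n = (2 : ℝ) ^ n • (a n * x) := by
    intro n
    rw [hxa, hax, smul_inv_smul₀ (by positivity)]
    exact ⟨rfl, rfl⟩
  choose w hw₁ hw₂ hw₃ using fun n => exists_approximate_unit (hpos n)
  have hcl := isClosed_her x
  have haza : ∀ n z, a n * z * a n ∈ her x := by
    intro n z
    refine hcl.mem_of_tendsto (((hw₃ n).mul_const z).mul (hw₂ n)) (.of_forall fun k => ?_)
    have heq : a n * (a n * w n k * a n) * z * (a n * w n k * a n * a n) =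
        (2 : ℝ) ^ n • (2 : ℝ) ^ n •
          (x * (a n * (w n k * a n * z * a n * w n k) * a n) * x) := by
      calc _ = (a n * a n) * (w n k * a n * z * a n * w n k) * (a n * a n) := by
            simp only [mul_assoc]
        _ = ((2 : ℝ) ^ n • (x * a n)) * (w n k * a n * z * a n * w n k) *
            ((2 : ℝ) ^ n • (a n * x)) := by
            rw [← (hsq n).1, ← (hsq n).2]
        _ = _ := by simp only [mul_smul_comm, smul_mul_assoc, mul_assoc]
    rw [heq]
    exact real_smul_mem _ (real_smul_mem _ (mul_mul_self_mem_her hx _))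
  have hu : ∀ n k, a n * w n k * a n ∈ her x := fun n k => haza n _
  have haB : ∀ n, a n ∈ her x := fun n =>
    hcl.mem_of_tendsto (hw₂ n) (.of_forall fun k => by
      simpa only [mul_assoc, SetLike.mem_coe] using haza n (w n k * a n))
  have hxB : x ∈ her x :=
    hcl.mem_of_tendsto hhas (.of_forall fun s => sum_mem fun n _ => real_smul_mem _ (haB n))
  have hher : ∀ p ∈ her x, ∀ q ∈ her x, ∀ y : A, p * y * q ∈ her x :=
    fun p hp q hq y => mul_mul_mem_her hx hp hq y
  rintro I hI ⟨x₀, hx₀⟩ ⟨e, he⟩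
  have hKc := isClosed_image_ideal hcl hI
  have hlarge : ∃ N, ∀ n ≥ N, a n ∈ Subtype.val '' (I : Set (her x)) := by
    have heB : (e : A) ∈ closure (Set.range fun y : A => x * y * x) := by
      rw [← coe_her_eq_closure hx]
      exact e.2
    obtain ⟨_, ⟨y, rfl⟩, hy⟩ := Metric.mem_closure_iff.1 heB (1 / 4) (by norm_num)
    have hlim : Tendsto (fun n : ℕ => ‖x * y‖ * (1 / 2 : ℝ) ^ n) atTop (𝓝 0) := by
      simpa using (tendsto_pow_atTop_nhds_zero_of_lt_one (r := (1 / 2 : ℝ)) (by norm_num)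
        (by norm_num)).const_mul ‖x * y‖
    obtain ⟨N, hN⟩ := eventually_atTop.1 (hlim.eventually_le_const (by norm_num : (0 : ℝ) < 1 / 4))
    refine ⟨N, fun n hn => ?_⟩
    refine mem_image_ideal_of_norm_mul_le hcl hI (fun z => (he z).2) (haB n) (hu n)
      (fun k => ?_) (hw₂ n)
    set u := a n * w n k * a n with hu_def
    have hxu : x * u = ((2 : ℝ) ^ n)⁻¹ • (a n * u) := by
      rw [hu_def, ← mul_assoc, ← mul_assoc, hxa]
      simp only [smul_mul_assoc, mul_assoc]
    have h₁ : ‖x * u‖ ≤ (1 / 2 : ℝ) ^ n := by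
      rw [hxu, norm_smul, Real.norm_of_nonneg (by positivity), one_div, inv_pow]
      exact mul_le_of_le_one_right (by positivity)
        ((norm_mul_le _ _).trans (mul_le_one₀ (hcontr n) (norm_nonneg _) (hw₁ n k)))
    have h₂ : (e : A) * u = (e - x * y * x) * u + x * y * (x * u) := by
      simp only [sub_mul, mul_assoc]
      abel
    rw [dist_eq_norm] at hy
    calc ‖(e : A) * u‖ ≤ ‖(e : A) - x * y * x‖ * ‖u‖ + ‖x * y‖ * ‖x * u‖ := by
          rw [h₂]
          exact norm_add_le_of_le (norm_mul_le _ _) (norm_mul_le _ _)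
      _ ≤ 1 / 4 * 1 + ‖x * y‖ * (1 / 2 : ℝ) ^ n := by
          gcongr
          exact hw₁ n k
      _ ≤ 1 / 2 := by linarith [hN n hn]
  obtain ⟨N, hN⟩ := hlarge
  have hdown : ∀ n, a (n + 1) ∈ Subtype.val '' (I : Set (her x)) →
      a n ∈ Subtype.val '' (I : Set (her x)) := fun n h =>
    (hlhd n).mem_image_ideal hcl hI hher (hu n) (hu (n + 1)) (hw₂ n) (hw₃ n)
      (hw₂ (n + 1)) (hw₃ (n + 1)) h
  have hall : ∀ n, a n ∈ Subtype.val '' (I : Set (her x)) := by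
    intro n
    rcases le_total N n with h | h
    · exact hN n h
    · exact Nat.decreasingInduction (fun k _ ih => hdown k ih) (hN N le_rfl) h
  have hxK : x ∈ Subtype.val '' (I : Set (her x)) := by
    refine hKc.mem_of_tendsto hhas (.of_forall fun s => ?_)
    refine Finset.sum_induction _ (· ∈ Subtype.val '' (I : Set (her x)))
      (fun _ _ => image_ideal_add_mem) zero_mem_image_ideal fun n _ => ?_
    refine hKc.mem_of_tendsto ((hw₂ n).const_smul ((2 : ℝ) ^ n)⁻¹) (.of_forall fun k => ?_)
    rw [← smul_mul_assoc]
    exact image_ideal_mul_mem (real_smul_mem _ (hu n k)) (hall n)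
  obtain ⟨v, -, hv, -⟩ := exists_approximate_unit hx0
  have hmem : (x₀ : A) ∈ Subtype.val '' (I : Set (her x)) := by
    have h₀ : (x₀ : A) ∈ closure (Set.range fun y : A => x * y * x) := by
      rw [← coe_her_eq_closure hx]
      exact x₀.2
    refine closure_minimal ?_ hKc h₀
    rintro _ ⟨y, rfl⟩
    refine hKc.mem_of_tendsto (hv.const_mul (x * y)) (.of_forall fun k => ?_)
    rw [← mul_assoc]
    exact image_ideal_mul_mem
      (hher x hxB _ (mul_mul_self_mem_her hx _) y) hxK
  obtain ⟨z, hz, hzx⟩ := hmem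
  exact hx₀ (Subtype.val_injective hzx ▸ hz)
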